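/- Define Φ(x) = x·J₀(x) + (π·x/2)·(H₀(x)·J₁(x) − H₁(x)·J₀(x)). For all natural numbers j, k and every real p > 0, the order-0 Hankel transform of the Haar wavelet ψ_{jk} satisfies ∫₀^∞ ψ_{jk}(r)·J₀(p·r) dr = (2^{j/2}/p)·(2·Φ(p·(k + 1/2)·2^{−j}) − Φ(p·k·2^{−j}) − Φ(p·(k+1)·2^{−j})). -/

import Mathlib

open Real MeasureTheory intervalIntegral

noncomputable def besselJ0 (x : ℝ) : ℝ :=
  (1 / Real.pi) * ∫ θ in (0:ℝ)..Real.pi, Real.cos (x * Real.sin θ)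

noncomputable def besselJ1 (x : ℝ) : ℝ :=
  (1 / Real.pi) * ∫ θ in (0:ℝ)..Real.pi, Real.cos (θ - x * Real.sin θ)

noncomputable def struveH0 (x : ℝ) : ℝ :=
  (2 / Real.pi) * ∫ θ in (0:ℝ)..(Real.pi / 2), Real.sin (x * Real.cos θ)

noncomputable def struveH1 (x : ℝ) : ℝ :=
  (2 * x / Real.pi) * ∫ θ in (0:ℝ)..(Real.pi / 2),
    Real.sin (x * Real.cos θ) * (Real.sin θ) ^ 2

noncomputable def besselPhi (x : ℝ) : ℝ :=
  x * besselJ0 x +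
    (Real.pi * x / 2) * (struveH0 x * besselJ1 x - struveH1 x * besselJ0 x)

noncomputable def haarPsi (t : ℝ) : ℝ :=
  if t ∈ Set.Ico (0 : ℝ) (1 / 2) then 1
  else if t ∈ Set.Ico (1 / 2 : ℝ) 1 then -1
  else 0

noncomputable def haarPsiJK (j k : ℕ) (t : ℝ) : ℝ :=
  2 ^ ((j : ℝ) / 2) * haarPsi (2 ^ j * t - k)

noncomputable def errorFun (x : ℝ) : ℝ :=
  (2 / Real.sqrt Real.pi) * ∫ t in (0:ℝ)..x, Real.exp (-t ^ 2)

/-- Differentiation under the integral sign for integrals of the form `∫ w θ * f (x * g θ)`. -/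
theorem hasDerivAt_integral_mul_comp_mul {f f' g w : ℝ → ℝ} (hf : ∀ y, HasDerivAt f (f' y) y)
    (hf' : Continuous f') (hbd : ∀ y, |f' y| ≤ 1) (hg : Continuous g) (hw : Continuous w)
    (a b x : ℝ) :
    HasDerivAt (fun x => ∫ θ in a..b, w θ * f (x * g θ))
      (∫ θ in a..b, w θ * (g θ * f' (x * g θ))) x := by
  have hfc : Continuous f := continuous_iff_continuousAt.2 fun y => (hf y).continuousAt
  refine (intervalIntegral.hasDerivAt_integral_of_dominated_loc_of_deriv_le
    (F := fun x θ => w θ * f (x * g θ)) (F' := fun x θ => w θ * (g θ * f' (x * g θ)))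
    (bound := fun θ => |w θ| * |g θ|) (s := Set.univ) Filter.univ_mem ?_ ?_ ?_ ?_ ?_ ?_).2
  · exact Filter.Eventually.of_forall fun y => (by fun_prop : Continuous fun θ =>
      w θ * f (y * g θ)).aestronglyMeasurable
  · exact (by fun_prop : Continuous fun θ => w θ * f (x * g θ)).intervalIntegrable _ _
  · exact (by fun_prop : Continuous fun θ =>
      w θ * (g θ * f' (x * g θ))).aestronglyMeasurable
  · refine Filter.Eventually.of_forall fun θ _ y _ => ?_
    rw [Real.norm_eq_abs, abs_mul, abs_mul]
    have := mul_le_mul_of_nonneg_left (hbd (y * g θ)) (abs_nonneg (g θ))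
    rw [mul_one] at this
    gcongr
  · exact (by fun_prop : Continuous fun θ => |w θ| * |g θ|).intervalIntegrable _ _
  · refine Filter.Eventually.of_forall fun θ _ y _ => ?_
    have h := ((hf (y * g θ)).comp y ((hasDerivAt_id y).mul_const (g θ))).const_mul (w θ)
    refine h.congr_deriv ?_
    ring

theorem hasDerivAt_integral_mul_cos {g w : ℝ → ℝ} (hg : Continuous g) (hw : Continuous w)
    (a b x : ℝ) :
    HasDerivAt (fun x => ∫ θ in a..b, w θ * Real.cos (x * g θ))
      (∫ θ in a..b, w θ * (g θ * -Real.sin (x * g θ))) x :=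
  hasDerivAt_integral_mul_comp_mul (f' := fun y => -Real.sin y) Real.hasDerivAt_cos
    (by fun_prop) (fun y => by simpa using Real.abs_sin_le_one y) hg hw a b x

theorem hasDerivAt_integral_mul_sin {g w : ℝ → ℝ} (hg : Continuous g) (hw : Continuous w)
    (a b x : ℝ) :
    HasDerivAt (fun x => ∫ θ in a..b, w θ * Real.sin (x * g θ))
      (∫ θ in a..b, w θ * (g θ * Real.cos (x * g θ))) x :=
  hasDerivAt_integral_mul_comp_mul Real.hasDerivAt_sin
    (by fun_prop) Real.abs_cos_le_one hg hw a b x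

theorem integral_cos_mul_cos_mul_sin (x : ℝ) :
    ∫ θ in (0:ℝ)..π, Real.cos θ * Real.cos (x * Real.sin θ) = 0 := by
  have h := intervalIntegral.integral_comp_sub_left (a := 0) (b := π)
    (fun θ => Real.cos θ * Real.cos (x * Real.sin θ)) π
  simp only [Real.cos_pi_sub, Real.sin_pi_sub, sub_self, sub_zero, neg_mul,
    intervalIntegral.integral_neg] at h
  linarith

theorem besselJ1_eq (x : ℝ) :
    besselJ1 x = (1 / π) * ∫ θ in (0:ℝ)..π, Real.sin θ * Real.sin (x * Real.sin θ) := by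
  simp only [besselJ1, Real.cos_sub]
  rw [intervalIntegral.integral_add (Continuous.intervalIntegrable (by fun_prop) _ _)
    (Continuous.intervalIntegrable (by fun_prop) _ _), integral_cos_mul_cos_mul_sin, zero_add]

theorem hasDerivAt_besselJ0 (x : ℝ) : HasDerivAt besselJ0 (-besselJ1 x) x := by
  have h := (hasDerivAt_integral_mul_cos Real.continuous_sin
    (continuous_const (y := (1 : ℝ))) 0 π x).const_mul (1 / π)
  simp only [one_mul, mul_neg, intervalIntegral.integral_neg] at h
  rw [besselJ1_eq]
  exact h

theorem hasDerivAt_mul_besselJ1 (x : ℝ) :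
    HasDerivAt (fun x => x * besselJ1 x) (x * besselJ0 x) x := by
  have h := (hasDerivAt_id x).mul ((hasDerivAt_integral_mul_sin Real.continuous_sin
    Real.continuous_sin 0 π x).const_mul (1 / π))
  have hparts : ∫ θ in (0:ℝ)..π, (-(Real.sin θ * Real.sin (x * Real.sin θ)) +
      x * (Real.cos θ ^ 2 * Real.cos (x * Real.sin θ))) = 0 := by
    rw [intervalIntegral.integral_eq_sub_of_hasDerivAt
      (f := fun θ => Real.cos θ * Real.sin (x * Real.sin θ))]
    · simp
    · intro θ _
      refine ((Real.hasDerivAt_cos θ).mul ((Real.hasDerivAt_sin θ).const_mul x).sin).congr_deriv ?_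
      ring
    · exact Continuous.intervalIntegrable (by fun_prop) _ _
  have hsplit : ∫ θ in (0:ℝ)..π, Real.cos (x * Real.sin θ) =
      (∫ θ in (0:ℝ)..π, Real.sin θ * (Real.sin θ * Real.cos (x * Real.sin θ))) +
      ∫ θ in (0:ℝ)..π, Real.cos θ ^ 2 * Real.cos (x * Real.sin θ) := by
    rw [← intervalIntegral.integral_add (Continuous.intervalIntegrable (by fun_prop) _ _)
      (Continuous.intervalIntegrable (by fun_prop) _ _)]
    congr 1 with θ
    linear_combination -Real.cos (x * Real.sin θ) * Real.sin_sq_add_cos_sq θ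
  rw [intervalIntegral.integral_add (Continuous.intervalIntegrable (by fun_prop) _ _)
    (Continuous.intervalIntegrable (by fun_prop) _ _), intervalIntegral.integral_neg,
    intervalIntegral.integral_const_mul] at hparts
  have hfun : (fun x => x * besselJ1 x) = id * fun x =>
      (1 / π) * ∫ θ in (0:ℝ)..π, Real.sin θ * Real.sin (x * Real.sin θ) := by
    funext y
    simp only [besselJ1_eq, Pi.mul_apply, id]
  rw [hfun]
  refine h.congr_deriv ?_
  rw [besselJ0, hsplit]
  simp only [id]
  linear_combination -(1 / π) * hparts

theorem hasDerivAt_struveH0 (x : ℝ) : HasDerivAt struveH0 (2 / π - struveH1 x) x := by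
  have h := (hasDerivAt_integral_mul_sin Real.continuous_cos
    (continuous_const (y := (1 : ℝ))) 0 (π / 2) x).const_mul (2 / π)
  simp only [one_mul] at h
  have hparts : ∫ θ in (0:ℝ)..(π / 2), (Real.cos θ * Real.cos (x * Real.cos θ) +
      x * (Real.sin (x * Real.cos θ) * Real.sin θ ^ 2)) = 1 := by
    rw [intervalIntegral.integral_eq_sub_of_hasDerivAt
      (f := fun θ => Real.sin θ * Real.cos (x * Real.cos θ))]
    · simp
    · intro θ _
      refine ((Real.hasDerivAt_sin θ).mul ((Real.hasDerivAt_cos θ).const_mul x).cos).congr_deriv ?_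
      ring
    · exact Continuous.intervalIntegrable (by fun_prop) _ _
  rw [intervalIntegral.integral_add (Continuous.intervalIntegrable (by fun_prop) _ _)
    (Continuous.intervalIntegrable (by fun_prop) _ _),
    intervalIntegral.integral_const_mul] at hparts
  refine HasDerivAt.congr_deriv (f := struveH0) h ?_
  rw [struveH1]
  linear_combination (2 / π) * hparts

theorem hasDerivAt_mul_struveH1 (x : ℝ) :
    HasDerivAt (fun x => x * struveH1 x) (x * struveH0 x) x := by
  have h := ((hasDerivAt_pow 2 x).const_mul (2 / π)).mul (hasDerivAt_integral_mul_sin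
    Real.continuous_cos (Real.continuous_sin.pow 2) 0 (π / 2) x)
  have hparts : ∫ θ in (0:ℝ)..(π / 2), (Real.sin (x * Real.cos θ) -
      2 * (Real.sin θ ^ 2 * Real.sin (x * Real.cos θ)) -
      x * (Real.sin θ ^ 2 * (Real.cos θ * Real.cos (x * Real.cos θ)))) = 0 := by
    rw [intervalIntegral.integral_eq_sub_of_hasDerivAt
      (f := fun θ => Real.cos θ * Real.sin θ * Real.sin (x * Real.cos θ))]
    · simp
    · intro θ _
      refine (((Real.hasDerivAt_cos θ).mul (Real.hasDerivAt_sin θ)).mul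
        ((Real.hasDerivAt_cos θ).const_mul x).sin).congr_deriv ?_
      simp only [Pi.mul_apply]
      linear_combination Real.sin (x * Real.cos θ) * Real.sin_sq_add_cos_sq θ
    · exact Continuous.intervalIntegrable (by fun_prop) _ _
  rw [intervalIntegral.integral_sub (Continuous.intervalIntegrable (by fun_prop) _ _)
    (Continuous.intervalIntegrable (by fun_prop) _ _),
    intervalIntegral.integral_sub (Continuous.intervalIntegrable (by fun_prop) _ _)
    (Continuous.intervalIntegrable (by fun_prop) _ _),
    intervalIntegral.integral_const_mul, intervalIntegral.integral_const_mul] at hparts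
  have hfun : (fun x => x * struveH1 x) = (fun x => 2 / π * x ^ 2) * fun x =>
      ∫ θ in (0:ℝ)..(π / 2), Real.sin θ ^ 2 * Real.sin (x * Real.cos θ) := by
    funext y
    simp only [struveH1, Pi.mul_apply, mul_comm (Real.sin _ ^ 2)]
    ring
  rw [hfun]
  refine h.congr_deriv ?_
  rw [struveH0]
  simp only [Nat.cast_ofNat]
  linear_combination -(2 * x / π) * hparts

/-- `besselPhi` is an antiderivative of `besselJ0`. -/
theorem hasDerivAt_besselPhi (x : ℝ) : HasDerivAt besselPhi (besselJ0 x) x := by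
  have h := ((hasDerivAt_id x).mul (hasDerivAt_besselJ0 x)).add
    ((((hasDerivAt_struveH0 x).mul (hasDerivAt_mul_besselJ1 x)).sub
      ((hasDerivAt_mul_struveH1 x).mul (hasDerivAt_besselJ0 x))).const_mul (π / 2))
  have hfun : besselPhi = fun x => x * besselJ0 x +
      π / 2 * (struveH0 x * (x * besselJ1 x) - x * struveH1 x * besselJ0 x) := by
    funext y
    rw [besselPhi]
    ring
  rw [hfun]
  refine HasDerivAt.congr_deriv h ?_
  simp only [id]
  field_simp
  ring

theorem continuous_besselJ0 : Continuous besselJ0 :=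
  continuous_iff_continuousAt.2 fun x => (hasDerivAt_besselJ0 x).continuousAt

theorem integral_besselJ0_mul {p : ℝ} (hp : p ≠ 0) (a b : ℝ) :
    ∫ r in a..b, besselJ0 (p * r) = (besselPhi (p * b) - besselPhi (p * a)) / p := by
  rw [intervalIntegral.integral_comp_mul_left _ hp,
    intervalIntegral.integral_eq_sub_of_hasDerivAt (fun x _ => hasDerivAt_besselPhi x)
      (continuous_besselJ0.intervalIntegrable _ _), smul_eq_mul]
  ring

theorem integral_Ioi_indicator_Ico {f : ℝ → ℝ} {a b : ℝ} (ha : 0 ≤ a) (hab : a ≤ b) :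
    ∫ r in Set.Ioi (0 : ℝ), (Set.Ico a b).indicator f r = ∫ r in a..b, f r := by
  rw [← integral_Ici_eq_integral_Ioi, setIntegral_indicator measurableSet_Ico,
    Set.inter_eq_right.2 fun x hx => Set.mem_Ici.2 (ha.trans hx.1),
    integral_Ico_eq_integral_Ioc, intervalIntegral.integral_of_le hab]

theorem haarPsi_eq_indicator (t : ℝ) :
    haarPsi t = (Set.Ico (0 : ℝ) (1 / 2)).indicator 1 t -
      (Set.Ico (1 / 2 : ℝ) 1).indicator 1 t := by
  by_cases h₁ : t ∈ Set.Ico (0 : ℝ) (1 / 2)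
  · have h₂ : t ∉ Set.Ico (1 / 2 : ℝ) 1 := fun h => absurd h₁.2 (not_lt.2 h.1)
    rw [haarPsi, if_pos h₁, Set.indicator_of_mem h₁, Set.indicator_of_notMem h₂]
    simp
  · by_cases h₂ : t ∈ Set.Ico (1 / 2 : ℝ) 1
    · rw [haarPsi, if_neg h₁, if_pos h₂, Set.indicator_of_notMem h₁, Set.indicator_of_mem h₂]
      simp
    · rw [haarPsi, if_neg h₁, if_neg h₂, Set.indicator_of_notMem h₁, Set.indicator_of_notMem h₂]
      simp

theorem mul_sub_mem_Ico_iff {c : ℝ} (hc : 0 < c) (k u v r : ℝ) :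
    c * r - k ∈ Set.Ico u v ↔ r ∈ Set.Ico ((k + u) * c⁻¹) ((k + v) * c⁻¹) := by
  rw [Set.mem_Ico, Set.mem_Ico, ← div_eq_mul_inv, ← div_eq_mul_inv, div_le_iff₀ hc, lt_div_iff₀ hc,
    mul_comm r c]
  constructor <;> rintro ⟨h₁, h₂⟩ <;> constructor <;> linarith

theorem hankel0_haar_wavelet (j k : ℕ) (p : ℝ) (hp : 0 < p) :
    ∫ r in Set.Ioi (0 : ℝ), haarPsiJK j k r * besselJ0 (p * r)
      = (2 ^ ((j : ℝ) / 2) / p) *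
          (2 * besselPhi (p * (((k : ℝ) + 1 / 2) * 2 ^ (-(j : ℝ))))
            - besselPhi (p * ((k : ℝ) * 2 ^ (-(j : ℝ))))
            - besselPhi (p * (((k : ℝ) + 1) * 2 ^ (-(j : ℝ))))) := by
  have hc : (0 : ℝ) < 2 ^ j := by positivity
  have hcj : (2 : ℝ) ^ (-(j : ℝ)) = (2 ^ j)⁻¹ := by
    rw [Real.rpow_neg (by norm_num), Real.rpow_natCast]
  rw [hcj]
  set c : ℝ := 2 ^ j with hcdef
  set a := (k : ℝ) * c⁻¹ with ha
  set b := ((k : ℝ) + 1 / 2) * c⁻¹ with hb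
  set d := ((k : ℝ) + 1) * c⁻¹ with hd
  have ha0 : 0 ≤ a := by positivity
  have hab : a ≤ b := mul_le_mul_of_nonneg_right (by linarith) (inv_nonneg.2 hc.le)
  have hbd : b ≤ d := mul_le_mul_of_nonneg_right (by linarith) (inv_nonneg.2 hc.le)
  have hcont : Continuous fun r => besselJ0 (p * r) := continuous_besselJ0.comp (by fun_prop)
  have hfun : ∀ r, haarPsiJK j k r * besselJ0 (p * r) = 2 ^ ((j : ℝ) / 2) *
      ((Set.Ico a b).indicator (fun r => besselJ0 (p * r)) r -
        (Set.Ico b d).indicator (fun r => besselJ0 (p * r)) r) := by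
    intro r
    have h₁ : c * r - k ∈ Set.Ico (0 : ℝ) (1 / 2) ↔ r ∈ Set.Ico a b := by
      simpa [ha, hb] using mul_sub_mem_Ico_iff hc k 0 (1 / 2) r
    have h₂ : c * r - k ∈ Set.Ico (1 / 2 : ℝ) 1 ↔ r ∈ Set.Ico b d :=
      mul_sub_mem_Ico_iff hc k (1 / 2) 1 r
    classical
    rw [haarPsiJK, ← hcdef, haarPsi_eq_indicator]
    simp only [Set.indicator_apply, h₁, h₂, Pi.one_apply]
    split_ifs <;> ring
  have hindicator : ∀ u v : ℝ, IntegrableOn ((Set.Ico u v).indicator fun r => besselJ0 (p * r))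
      (Set.Ioi 0) := fun u v =>
    ((integrable_indicator_iff measurableSet_Ico).2
      (hcont.integrableOn_Icc.mono_set Set.Ico_subset_Icc_self)).integrableOn
  simp only [hfun]
  rw [MeasureTheory.integral_const_mul, MeasureTheory.integral_sub (hindicator a b) (hindicator b d),
    integral_Ioi_indicator_Ico ha0 hab, integral_Ioi_indicator_Ico (ha0.trans hab) hbd,
    integral_besselJ0_mul hp.ne', integral_besselJ0_mul hp.ne']
  ring
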